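/- There is a function σ from the language ConWON to its flat fragment ConWON-1 such that for every formula φ of ConWON, the formula φ ↔ σ(φ) is valid in ConWON. (Hence ConWON is no more expressive than its flat fragment.) -/

import Mathlib

open Classical in
/-- Greedy intersection: keep intersecting with successive defaults as long as nonempty. -/
noncomputable def eAux {W : Type*} : Set W → List (Set W) → Set W
  | A, [] => A
  | A, E :: rest => if (A ∩ E).Nonempty then eAux (A ∩ E) rest else A

/-- Expected states of a context (list of defaults). -/
noncomputable def expect {W : Type*} : List (Set W) → Set W
  | [] => Set.univ
  | D :: rest => eAux D rest

/-- Propositional formulas over a countable set of atoms (identified with ℕ). -/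
inductive PForm : Type
  | atom : ℕ → PForm
  | fls : PForm
  | neg : PForm → PForm
  | conj : PForm → PForm → PForm

/-- The language ConWON: propositional connectives plus the conditional [α]φ
with propositional antecedent. -/
inductive Form : Type
  | atom : ℕ → Form
  | fls : Form
  | neg : Form → Form
  | conj : Form → Form → Form
  | cond : PForm → Form → Form

/-- Extension ⟦α⟧ of a propositional formula in a model (W, V). -/
def pval {W : Type*} (V : ℕ → Set W) : PForm → Set W
  | .atom n => V n
  | .fls => ∅
  | .neg a => (pval V a)ᶜ
  | .conj a b => pval V a ∩ pval V b

/-- Truth at a contextualized pointed model: M,C,w ⊨ φ. -/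
def sat {W : Type*} (V : ℕ → Set W) : List (Set W) → W → Form → Prop
  | _, w, .atom n => w ∈ V n
  | _, _, .fls => False
  | C, w, .neg φ => ¬ sat V C w φ
  | C, w, .conj φ ψ => sat V C w φ ∧ sat V C w ψ
  | C, _, .cond α φ => ∀ u ∈ expect (pval V α :: C), sat V (pval V α :: C) u φ

universe u

/-- Validity in ConWON: truth at every contextualized pointed model. -/
def valid (φ : Form) : Prop :=
  ∀ (W : Type u) (_ : Nonempty W) (V : ℕ → Set W) (C : List (Set W)),
    C ≠ [] → ∀ w : W, sat V C w φ

def Form.top : Form := .neg .fls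
def Form.or (φ ψ : Form) : Form := .neg (.conj (.neg φ) (.neg ψ))
def Form.imp (φ ψ : Form) : Form := .neg (.conj φ (.neg ψ))
def Form.iff (φ ψ : Form) : Form := .conj (.imp φ ψ) (.imp ψ φ)
/-- ⟨α⟩φ := ¬[α]¬φ. -/
def Form.dia (α : PForm) (φ : Form) : Form := .neg (.cond α (.neg φ))
/-- Eα := ⟨α⟩⊤. -/
def Form.E (α : PForm) : Form := Form.dia α Form.top
/-- Aα := ¬E¬α. -/
def Form.A (α : PForm) : Form := .neg (Form.E (.neg α))
def PForm.imp (a b : PForm) : PForm := .neg (.conj a (.neg b))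

/-- Embedding of propositional formulas into ConWON. -/
def pToForm : PForm → Form
  | .atom n => .atom n
  | .fls => .fls
  | .neg a => .neg (pToForm a)
  | .conj a b => .conj (pToForm a) (pToForm b)

/-- Closed formulas: χ ::= [α]φ | ¬χ | (χ∧χ). -/
inductive Closed : Form → Prop
  | cond (α : PForm) (φ : Form) : Closed (.cond α φ)
  | neg {χ : Form} : Closed χ → Closed (.neg χ)
  | conj {χ₁ χ₂ : Form} : Closed χ₁ → Closed χ₂ → Closed (.conj χ₁ χ₂)

/-- Conditional-free formulas of ConWON. -/
def CondFree : Form → Prop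
  | .atom _ => True
  | .fls => True
  | .neg φ => CondFree φ
  | .conj φ ψ => CondFree φ ∧ CondFree ψ
  | .cond _ _ => False

/-- The flat fragment ConWON-1: no conditional occurs inside another conditional. -/
def Flat : Form → Prop
  | .atom _ => True
  | .fls => True
  | .neg φ => Flat φ
  | .conj φ ψ => Flat φ ∧ Flat ψ
  | .cond _ φ => CondFree φ

theorem eAux_subset {W : Type*} (A : Set W) (L : List (Set W)) : eAux A L ⊆ A := by
  induction L generalizing A with
  | nil => exact subset_rfl
  | cons E L ih =>
    rw [eAux]
    split_ifs
    · exact (ih _).trans Set.inter_subset_left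
    · exact subset_rfl

theorem eAux_nonempty {W : Type*} {A : Set W} (hA : A.Nonempty) (L : List (Set W)) :
    (eAux A L).Nonempty := by
  induction L generalizing A with
  | nil => exact hA
  | cons E L ih =>
    rw [eAux]
    split_ifs with h
    · exact ih h
    · exact hA

theorem eAux_eq_empty_iff {W : Type*} {A : Set W} {L : List (Set W)} :
    eAux A L = ∅ ↔ A = ∅ := by
  constructor
  · intro h
    by_contra hA
    exact (eAux_nonempty (Set.nonempty_iff_ne_empty.mpr hA) L).ne_empty h
  · rintro rfl
    exact Set.subset_empty_iff.mp (eAux_subset ∅ L)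

theorem sat_pToForm {W : Type*} (V : ℕ → Set W) (C : List (Set W)) (w : W) (π : PForm) :
    sat V C w (pToForm π) ↔ w ∈ pval V π := by
  induction π with
  | atom n => rfl
  | fls => rfl
  | neg a ih => simp [pToForm, sat, pval, ih]
  | conj a b iha ihb => simp [pToForm, sat, pval, iha, ihb]

theorem condFree_pToForm (π : PForm) : CondFree (pToForm π) := by
  induction π with
  | atom n => trivial
  | fls => trivial
  | neg a ih => exact ih
  | conj a b iha ihb => exact ⟨iha, ihb⟩

theorem CondFree.flat {φ : Form} (h : CondFree φ) : Flat φ := by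
  induction φ with
  | atom n => trivial
  | fls => trivial
  | neg φ ih => exact ih h
  | conj φ ψ ihφ ihψ => exact ⟨ihφ h.1, ihψ h.2⟩
  | cond α φ => exact h.elim

/-- `branch χ φ ψ` is "if `χ` then `φ` else `ψ`". -/
def Form.branch (χ φ ψ : Form) : Form := .or (.conj χ φ) (.conj (.neg χ) ψ)

theorem sat_branch {W : Type*} {V : ℕ → Set W} {C : List (Set W)} {w : W} {χ φ ψ : Form} :
    sat V C w (.branch χ φ ψ) ↔ (sat V C w χ → sat V C w φ) ∧ (¬ sat V C w χ → sat V C w ψ) := by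
  simp only [Form.branch, Form.or, sat]
  tauto

theorem Flat.branch {χ φ ψ : Form} (hχ : Flat χ) (hφ : Flat φ) (hψ : Flat ψ) :
    Flat (.branch χ φ ψ) :=
  ⟨⟨hχ, hφ⟩, ⟨hχ, hψ⟩⟩

theorem sat_iff {W : Type*} {V : ℕ → Set W} {C : List (Set W)} {w : W} {φ ψ : Form} :
    sat V C w (.iff φ ψ) ↔ (sat V C w φ ↔ sat V C w ψ) := by
  simp only [Form.iff, Form.imp, sat]
  tauto

/-- `[α]⊥`: no state satisfies `α`. -/
def Form.isEmpty (α : PForm) : Form := .cond α .fls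

theorem sat_isEmpty {W : Type*} {V : ℕ → Set W} {C : List (Set W)} {w : W} {α : PForm} :
    sat V C w (.isEmpty α) ↔ pval V α = ∅ := by
  simp only [Form.isEmpty, sat, expect]
  rw [← eAux_eq_empty_iff (L := C), Set.eq_empty_iff_forall_notMem]

/-- Flat formula saying in context `C` that `π` holds at all states expected in the context
`γ; Γ; C`. -/
def expectAll (π : PForm) : PForm → List PForm → Form
  | γ, [] => .cond γ (pToForm π)
  | γ, δ :: Γ =>
    .branch (.isEmpty (.conj γ δ)) (.isEmpty (.conj γ (.neg π))) (expectAll π (.conj γ δ) Γ)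

theorem flat_expectAll (π γ : PForm) (Γ : List PForm) : Flat (expectAll π γ Γ) := by
  induction Γ generalizing γ with
  | nil => exact condFree_pToForm π
  | cons δ Γ ih => exact Flat.branch trivial trivial (ih _)

theorem sat_expectAll {W : Type*} (V : ℕ → Set W) (C : List (Set W)) (w : W) (π γ : PForm)
    (Γ : List PForm) :
    sat V C w (expectAll π γ Γ) ↔ eAux (pval V γ) (Γ.map (pval V) ++ C) ⊆ pval V π := by
  induction Γ generalizing γ with
  | nil => simp only [expectAll, sat, sat_pToForm, expect]; rfl
  | cons δ Γ ih =>
    simp only [expectAll, sat_branch, sat_isEmpty, ih, List.map_cons, List.cons_append, eAux, pval,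
      Set.nonempty_iff_ne_empty, ← Set.sdiff_eq, Set.sdiff_eq_empty]
    split_ifs <;> tauto

/-- Truth of `φ` in the context `Γ; C`, expressed in the context `C`. In any given context, `φ` is
equivalent to a propositional formula `π`; case distinctions on flat formulas find such a `π`, which
is passed to the continuation `k`. -/
def Form.flatten : Form → List PForm → (PForm → Form) → Form
  | .atom n, _, k => k (.atom n)
  | .fls, _, k => k .fls
  | .neg φ, Γ, k => φ.flatten Γ fun π => k (.neg π)
  | .conj φ ψ, Γ, k => φ.flatten Γ fun π => ψ.flatten Γ fun ρ => k (.conj π ρ)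
  | .cond α φ, Γ, k =>
    .branch (φ.flatten (α :: Γ) fun π => expectAll π α Γ) (k (.neg .fls)) (k .fls)

theorem Form.flat_flatten (φ : Form) (Γ : List PForm) {k : PForm → Form}
    (hk : ∀ π, Flat (k π)) : Flat (φ.flatten Γ k) := by
  induction φ generalizing Γ k with
  | atom n => exact hk _
  | fls => exact hk _
  | neg φ ih => exact ih Γ fun π => hk _
  | conj φ ψ ihφ ihψ => exact ihφ Γ fun π => ihψ Γ fun ρ => hk _
  | cond α φ ih => exact Flat.branch (ih _ fun π => flat_expectAll π α Γ) (hk _) (hk _)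

theorem Form.exists_sat_flatten_iff {W : Type*} (V : ℕ → Set W) (C : List (Set W)) (φ : Form)
    (Γ : List PForm) :
    ∃ π : PForm, (∀ u, sat V (Γ.map (pval V) ++ C) u φ ↔ u ∈ pval V π) ∧
      ∀ (k : PForm → Form) (w : W), sat V C w (φ.flatten Γ k) ↔ sat V C w (k π) := by
  induction φ generalizing Γ with
  | atom n => exact ⟨.atom n, fun u => Iff.rfl, fun k w => Iff.rfl⟩
  | fls => exact ⟨.fls, fun u => Iff.rfl, fun k w => Iff.rfl⟩
  | neg φ ih =>
    obtain ⟨π, hπ, hk⟩ := ih Γ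
    exact ⟨.neg π, fun u => not_congr (hπ u), fun k w => hk _ w⟩
  | conj φ ψ ihφ ihψ =>
    obtain ⟨π, hπ, hk⟩ := ihφ Γ
    obtain ⟨ρ, hρ, hl⟩ := ihψ Γ
    exact ⟨.conj π ρ, fun u => and_congr (hπ u) (hρ u), fun k w => (hk _ w).trans (hl _ w)⟩
  | cond α φ ih =>
    obtain ⟨π, hπ, hk⟩ := ih (α :: Γ)
    simp only [List.map_cons, List.cons_append] at hπ
    simp only [Form.flatten, sat_branch, hk, sat_expectAll, sat, hπ, expect]
    by_cases h : eAux (pval V α) (Γ.map (pval V) ++ C) ⊆ pval V π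
    · exact ⟨.neg .fls, fun u => iff_of_true h id, fun k w => by simp [h]⟩
    · exact ⟨.fls, fun u => iff_of_false h id, fun k w => by simp [h]⟩

/-- There is a translation σ of ConWON into its flat fragment ConWON-1 such that
φ ↔ σ(φ) is valid for every formula φ. -/
theorem exists_flat_translation :
    ∃ σ : Form → Form, ∀ φ : Form, Flat (σ φ) ∧ valid (Form.iff φ (σ φ)) := by
  refine ⟨fun φ => φ.flatten [] pToForm, fun φ =>
    ⟨φ.flat_flatten [] fun π => (condFree_pToForm π).flat, fun W _ V C _ w => ?_⟩⟩
  obtain ⟨π, hπ, hk⟩ := φ.exists_sat_flatten_iff V C []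
  rw [sat_iff, hk, sat_pToForm]
  exact hπ w
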